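/- (Differential inequality for the cylinder energy, combination of (en) and (id3) in Proposition 2.3) For every dimension n ≥ 1 there exist constants ε₂ > 0 and C > 0 with the following property: let T ≥ 3 and let f : ℝ² → ℝⁿ be smooth, 2π-periodic in θ, weakly conformal, with Δf = 0 at every point where ∇f = 0, and suppose that for some ε with 0 < ε ≤ ε₂, sup_{s ∈ [−T, T−1]} W(f, [s,s+1]×[0,2π]) < ε². Define φ(t) = (1/2)∫_{[−t,t]×[0,2π]} |∇f|² for t ∈ [0, T]. Then φ(t) ≤ φ'(t) + Cε φ(t+2) for all t ∈ [0, T−2]. -/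

import Mathlib

open MeasureTheory Set Filter
open scoped ENNReal Real RealInnerProductSpace

/-- Partial derivative in the first coordinate direction. -/
noncomputable def pd1 {n : ℕ} (f : ℝ × ℝ → EuclideanSpace ℝ (Fin n)) (z : ℝ × ℝ) :
    EuclideanSpace ℝ (Fin n) := fderiv ℝ f z (1, 0)

/-- Partial derivative in the second coordinate direction. -/
noncomputable def pd2 {n : ℕ} (f : ℝ × ℝ → EuclideanSpace ℝ (Fin n)) (z : ℝ × ℝ) :
    EuclideanSpace ℝ (Fin n) := fderiv ℝ f z (0, 1)

/-- `|∇f|²`. -/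
noncomputable def gradSq {n : ℕ} (f : ℝ × ℝ → EuclideanSpace ℝ (Fin n)) (z : ℝ × ℝ) : ℝ :=
    ‖pd1 f z‖ ^ 2 + ‖pd2 f z‖ ^ 2

/-- The Laplacian `Δf = ∂²f/∂x² + ∂²f/∂y²`. -/
noncomputable def lap {n : ℕ} (f : ℝ × ℝ → EuclideanSpace ℝ (Fin n)) (z : ℝ × ℝ) :
    EuclideanSpace ℝ (Fin n) := pd1 (pd1 f) z + pd2 (pd2 f) z

/-- The Willmore energy `W(f, Ω) = ∫_{Ω ∩ {∇f ≠ 0}} |Δf|²/|∇f|²`. -/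
noncomputable def willmore {n : ℕ} (f : ℝ × ℝ → EuclideanSpace ℝ (Fin n))
    (Ω : Set (ℝ × ℝ)) : ℝ≥0∞ :=
  ∫⁻ z in Ω ∩ {w | gradSq f w ≠ 0}, ENNReal.ofReal (‖lap f z‖ ^ 2 / gradSq f z)

section CylinderCalculus

variable {n : ℕ}

/-- Wirtinger's inequality for complex-valued functions on an interval of length `2π`. -/
lemma wirtinger_complex {u u' : ℝ → ℂ} (hu : ∀ x, HasDerivAt u (u' x) x) (hu' : Continuous u')
    (hper : u (2 * π) = u 0) (hmean : ∫ x in (0 : ℝ)..2 * π, u x = 0) :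
    ∫ x in (0 : ℝ)..2 * π, ‖u x‖ ^ 2 ≤ ∫ x in (0 : ℝ)..2 * π, ‖u' x‖ ^ 2 := by
  have hpi : (0 : ℝ) < 2 * π := by positivity
  have huc : Continuous u := continuous_iff_continuousAt.2 fun x => (hu x).continuousAt
  have hmem : ∀ v : ℝ → ℂ, Continuous v → MemLp v 2 (volume.restrict (Ioc 0 (2 * π))) := by
    intro v hv
    obtain ⟨B, hB⟩ := (isCompact_Icc (a := (0 : ℝ)) (b := 2 * π)).exists_bound_of_continuousOn
      hv.continuousOn
    refine MemLp.of_bound hv.aestronglyMeasurable B ?_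
    filter_upwards [ae_restrict_mem measurableSet_Ioc] with x hx
    exact hB x (Ioc_subset_Icc_self hx)
  have h1 := hasSum_sq_fourierCoeffOn hpi (hmem u huc)
  have h2 := hasSum_sq_fourierCoeffOn hpi (hmem u' hu')
  have hle : ∀ k : ℤ, ‖fourierCoeffOn hpi u k‖ ^ 2 ≤ ‖fourierCoeffOn hpi u' k‖ ^ 2 := by
    intro k
    by_cases hk : k = 0
    · subst hk
      have : fourierCoeffOn hpi u 0 = 0 := by
        rw [fourierCoeffOn_eq_integral]
        simp [hmean]
      rw [this]
      simp
    · have h := fourierCoeffOn_of_hasDerivAt hpi hk (fun x _ => hu x)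
        (hu'.intervalIntegrable 0 (2 * π))
      rw [hper, sub_self, mul_zero, zero_sub] at h
      have hk1 : (1 : ℝ) ≤ ‖(k : ℂ)‖ := by
        rw [Complex.norm_intCast]
        exact_mod_cast Int.one_le_abs hk
      have h3 : fourierCoeffOn hpi u' k = (Complex.I * k) * fourierCoeffOn hpi u k := by
        rw [h]
        have : (k : ℂ) ≠ 0 := by exact_mod_cast hk
        have hpc : (π : ℂ) ≠ 0 := by exact_mod_cast Real.pi_ne_zero
        push_cast
        field_simp
        ring
      rw [h3, norm_mul, norm_mul, Complex.norm_I, one_mul]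
      gcongr
      nlinarith [norm_nonneg (fourierCoeffOn hpi u k)]
  have h := hasSum_le hle h1 h2
  simp only [sub_zero, smul_eq_mul] at h
  exact le_of_mul_le_mul_left h (by positivity)

/-- Wirtinger's inequality for closed curves in Euclidean space. -/
lemma wirtinger {u u' : ℝ → EuclideanSpace ℝ (Fin n)} (hu : ∀ x, HasDerivAt u (u' x) x)
    (hu' : Continuous u') (hper : u (2 * π) = u 0)
    (hmean : ∫ x in (0 : ℝ)..2 * π, u x = 0) :
    ∫ x in (0 : ℝ)..2 * π, ‖u x‖ ^ 2 ≤ ∫ x in (0 : ℝ)..2 * π, ‖u' x‖ ^ 2 := by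
  have huc : Continuous u := continuous_iff_continuousAt.2 fun x => (hu x).continuousAt
  simp only [EuclideanSpace.norm_sq_eq]
  rw [intervalIntegral.integral_finsetSum, intervalIntegral.integral_finsetSum]
  · refine Finset.sum_le_sum fun i _ => ?_
    have hd : ∀ x, HasDerivAt (fun x => ((u x i : ℝ) : ℂ)) ((u' x i : ℝ) : ℂ) x := fun x =>
      (((EuclideanSpace.proj (𝕜 := ℝ) i).hasFDerivAt.comp_hasDerivAt x (hu x))).ofReal_comp
    have := wirtinger_complex hd (by fun_prop) (by simp only [hper]) ?_
    · simpa only [Complex.norm_real] using this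
    · rw [intervalIntegral.integral_ofReal]
      have h := (EuclideanSpace.proj (𝕜 := ℝ) i :
        EuclideanSpace ℝ (Fin n) →L[ℝ] ℝ).intervalIntegral_comp_comm
        (huc.intervalIntegrable (μ := volume) 0 (2 * π))
      rw [hmean, map_zero] at h
      change ∫ x in (0 : ℝ)..2 * π, u x i = 0 at h
      rw [h, Complex.ofReal_zero]
  · intro i _
    exact Continuous.intervalIntegrable (by fun_prop) _ _
  · intro i _
    exact Continuous.intervalIntegrable (by fun_prop) _ _

/-- The portion `a ≤ t ≤ b` of the cylinder, cut open along a line. -/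
def band (a b : ℝ) : Set (ℝ × ℝ) := Icc a b ×ˢ Icc 0 (2 * π)

lemma isCompact_band (a b : ℝ) : IsCompact (band a b) := isCompact_Icc.prod isCompact_Icc

lemma band_subset {a b c d : ℝ} (h1 : c ≤ a) (h2 : b ≤ d) : band a b ⊆ band c d :=
  prod_mono (Icc_subset_Icc h1 h2) subset_rfl

lemma Continuous.integrableOn_band {F : Type*} [NormedAddCommGroup F] {u : ℝ × ℝ → F}
    (hu : Continuous u) (a b : ℝ) : IntegrableOn u (band a b) :=
  hu.continuousOn.integrableOn_compact (isCompact_band a b)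

lemma integral_band {F : Type*} [NormedAddCommGroup F] [NormedSpace ℝ F] {u : ℝ × ℝ → F}
    (hu : Continuous u) {a b : ℝ} (hab : a ≤ b) :
    ∫ z in band a b, u z = ∫ t in a..b, ∫ θ in (0 : ℝ)..2 * π, u (t, θ) := by
  have hpi : (0 : ℝ) ≤ 2 * π := by positivity
  have h := hu.integrableOn_band a b
  rw [band, Measure.volume_eq_prod] at *
  rw [setIntegral_prod _ h, intervalIntegral.integral_of_le hab, integral_Icc_eq_integral_Ioc]
  simp only [intervalIntegral.integral_of_le hpi, integral_Icc_eq_integral_Ioc]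

lemma continuous_slice_integral {F : Type*} [NormedAddCommGroup F] [NormedSpace ℝ F]
    {u : ℝ × ℝ → F} (hu : Continuous u) :
    Continuous fun t => ∫ θ in (0 : ℝ)..2 * π, u (t, θ) :=
  intervalIntegral.continuous_parametric_intervalIntegral_of_continuous'
    (f := fun t θ => u (t, θ)) hu _ _

variable {f X : ℝ × ℝ → EuclideanSpace ℝ (Fin n)}

lemma ContDiff.pd1 {m k : WithTop ℕ∞} (hf : ContDiff ℝ k f) (hm : m + 1 ≤ k) :
    ContDiff ℝ m (pd1 f) :=
  (hf.fderiv_right hm).clm_apply contDiff_const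

lemma ContDiff.pd2 {m k : WithTop ℕ∞} (hf : ContDiff ℝ k f) (hm : m + 1 ≤ k) :
    ContDiff ℝ m (pd2 f) :=
  (hf.fderiv_right hm).clm_apply contDiff_const

lemma hasDerivAt_pd1 (hf : Differentiable ℝ f) (t θ : ℝ) :
    HasDerivAt (fun t => f (t, θ)) (pd1 f (t, θ)) t :=
  (hf (t, θ)).hasFDerivAt.comp_hasDerivAt t ((hasDerivAt_id t).prodMk (hasDerivAt_const t θ))

lemma hasDerivAt_pd2 (hf : Differentiable ℝ f) (t θ : ℝ) :
    HasDerivAt (fun θ => f (t, θ)) (pd2 f (t, θ)) θ :=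
  (hf (t, θ)).hasFDerivAt.comp_hasDerivAt θ ((hasDerivAt_const θ t).prodMk (hasDerivAt_id θ))

lemma pd1_pd2_comm (hf : ContDiff ℝ 2 f) (z : ℝ × ℝ) : pd1 (pd2 f) z = pd2 (pd1 f) z := by
  have hd : DifferentiableAt ℝ (fderiv ℝ f) z :=
    (hf.fderiv_right (m := 1) (by norm_num)).differentiable (by norm_num) z
  have hs : IsSymmSndFDerivAt ℝ f z := hf.contDiffAt.isSymmSndFDerivAt (by simp)
  have h1 : pd1 (pd2 f) z = fderiv ℝ (fderiv ℝ f) z (1, 0) (0, 1) := by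
    unfold pd1 pd2
    rw [fderiv_clm_apply hd (differentiableAt_const _)]
    simp
  have h2 : pd2 (pd1 f) z = fderiv ℝ (fderiv ℝ f) z (0, 1) (1, 0) := by
    unfold pd1 pd2
    rw [fderiv_clm_apply hd (differentiableAt_const _)]
    simp
  rw [h1, h2]
  exact hs _ _

lemma pd2_periodic (hper : ∀ t θ : ℝ, f (t, θ + 2 * π) = f (t, θ)) (t θ : ℝ) :
    pd2 f (t, θ + 2 * π) = pd2 f (t, θ) := by
  have h : (fun z : ℝ × ℝ => f (z + (0, 2 * π))) = f := by
    ext1 ⟨t, θ⟩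
    simpa using hper t θ
  have := fderiv_comp_add_right (𝕜 := ℝ) (f := f) (x := (t, θ)) (0, 2 * π)
  rw [h] at this
  simp only [pd2, this, Prod.mk_add_mk, add_zero]

/-- The Laplacian of a weakly conformal map is normal. -/
lemma inner_lap_of_conformal (hf : ContDiff ℝ 2 f)
    (hconf : ∀ z, ‖pd1 f z‖ ^ 2 = ‖pd2 f z‖ ^ 2 ∧ ⟪pd1 f z, pd2 f z⟫ = 0) (z : ℝ × ℝ) :
    ⟪lap f z, pd1 f z⟫ = 0 ∧ ⟪lap f z, pd2 f z⟫ = 0 := by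
  have d1 : Differentiable ℝ (pd1 f) := (hf.pd1 (m := 1) (by norm_num)).differentiable (by norm_num)
  have d2 : Differentiable ℝ (pd2 f) := (hf.pd2 (m := 1) (by norm_num)).differentiable (by norm_num)
  obtain ⟨t, θ⟩ := z
  have hs := pd1_pd2_comm hf (t, θ)
  have hn : ∀ z, ⟪pd1 f z, pd1 f z⟫ = ⟪pd2 f z, pd2 f z⟫ := fun z => by
    simpa only [real_inner_self_eq_norm_sq] using (hconf z).1
  have a1 := (hasDerivAt_pd1 d1 t θ).inner ℝ (hasDerivAt_pd1 d1 t θ)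
  have b1 := (hasDerivAt_pd1 d2 t θ).inner ℝ (hasDerivAt_pd1 d2 t θ)
  simp only [hn] at a1
  have e1 := a1.unique b1
  have a2 := (hasDerivAt_pd2 d1 t θ).inner ℝ (hasDerivAt_pd2 d1 t θ)
  have b2 := (hasDerivAt_pd2 d2 t θ).inner ℝ (hasDerivAt_pd2 d2 t θ)
  simp only [hn] at a2
  have e2 := a2.unique b2
  have c1 := (hasDerivAt_pd1 d1 t θ).inner ℝ (hasDerivAt_pd1 d2 t θ)
  have c2 := (hasDerivAt_pd2 d1 t θ).inner ℝ (hasDerivAt_pd2 d2 t θ)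
  simp only [(hconf _).2] at c1 c2
  have e3 := c1.unique (hasDerivAt_const t (0 : ℝ))
  have e4 := c2.unique (hasDerivAt_const θ (0 : ℝ))
  rw [hs] at e1 e3
  simp only [lap, inner_add_left]
  rw [real_inner_comm (pd1 (pd1 f) (t, θ))] at e1
  rw [real_inner_comm (pd2 (pd1 f) (t, θ)) (pd2 f (t, θ))] at e1
  rw [real_inner_comm (pd2 (pd1 f) (t, θ)) (pd1 f (t, θ))] at e2 e3
  rw [real_inner_comm (pd2 (pd2 f) (t, θ)) (pd2 f (t, θ))] at e2
  rw [real_inner_comm (pd2 (pd2 f) (t, θ)) (pd1 f (t, θ))] at e4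
  constructor <;> linarith

lemma continuous_lap (hf : ContDiff ℝ 2 f) : Continuous (lap f) :=
  (((hf.pd1 (m := 1) (by norm_num)).pd1 (m := 0) (by norm_num)).continuous).add
    (((hf.pd2 (m := 1) (by norm_num)).pd2 (m := 0) (by norm_num)).continuous)

lemma continuous_gradSq (hf : ContDiff ℝ 1 f) : Continuous (gradSq f) :=
  ((hf.pd1 (m := 0) (by norm_num)).continuous.norm.pow 2).add
    ((hf.pd2 (m := 0) (by norm_num)).continuous.norm.pow 2)

lemma gradSq_nonneg (z : ℝ × ℝ) : 0 ≤ gradSq f z := by unfold gradSq; positivity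

/-- Green's formula on a portion of the cylinder. -/
lemma green_band (hf : ContDiff ℝ 2 f) (hX : ContDiff ℝ 1 X)
    (hfper : ∀ t θ : ℝ, f (t, θ + 2 * π) = f (t, θ))
    (hXper : ∀ t θ : ℝ, X (t, θ + 2 * π) = X (t, θ)) {a b : ℝ} (hab : a ≤ b) :
    ∫ z in band a b, (⟪pd1 X z, pd1 f z⟫ + ⟪pd2 X z, pd2 f z⟫ + ⟪X z, lap f z⟫) =
      (∫ θ in (0 : ℝ)..2 * π, ⟪X (b, θ), pd1 f (b, θ)⟫) -
        ∫ θ in (0 : ℝ)..2 * π, ⟪X (a, θ), pd1 f (a, θ)⟫ := by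
  have c1 : ContDiff ℝ 1 (pd1 f) := hf.pd1 (by norm_num)
  have c2 : ContDiff ℝ 1 (pd2 f) := hf.pd2 (by norm_num)
  have F1 : ContDiff ℝ 1 fun z => ⟪X z, pd1 f z⟫ := hX.inner ℝ c1
  have F2 : ContDiff ℝ 1 fun z => ⟪X z, pd2 f z⟫ := hX.inner ℝ c2
  have hX1 := (hX.pd1 (m := 0) (by norm_num)).continuous
  have hX2 := (hX.pd2 (m := 0) (by norm_num)).continuous
  have hl := continuous_lap hf
  have key : ∀ z, fderiv ℝ (fun z => ⟪X z, pd1 f z⟫) z (1, 0)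
      + fderiv ℝ (fun z => ⟪X z, pd2 f z⟫) z (0, 1) =
      ⟪pd1 X z, pd1 f z⟫ + ⟪pd2 X z, pd2 f z⟫ + ⟪X z, lap f z⟫ := by
    intro z
    rw [fderiv_inner_apply ℝ (hX.differentiable (by norm_num) z)
        (c1.differentiable (by norm_num) z),
      fderiv_inner_apply ℝ (hX.differentiable (by norm_num) z)
        (c2.differentiable (by norm_num) z)]
    simp only [lap, inner_add_right]
    change ⟪X z, pd1 (pd1 f) z⟫ + ⟪pd1 X z, pd1 f z⟫ +
      (⟪X z, pd2 (pd2 f) z⟫ + ⟪pd2 X z, pd2 f z⟫) = _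
    ring
  have h := integral_divergence_prod_Icc_of_hasFDerivAt_of_le _ _ _ _ (a, 0) (b, 2 * π)
    ⟨hab, by positivity⟩ F1.continuous.continuousOn F2.continuous.continuousOn
    (fun z _ => (F1.differentiable (by norm_num) z).hasFDerivAt)
    (fun z _ => (F2.differentiable (by norm_num) z).hasFDerivAt)
    (by
      simp only [key]
      exact (Continuous.continuousOn (by
        have := hX.continuous; have := c1.continuous; have := c2.continuous
        fun_prop)).integrableOn_compact isCompact_Icc)
  simp only [key] at h
  rw [← Icc_prod_Icc] at h
  have hb : ∀ x, ⟪X (x, 2 * π), pd2 f (x, 2 * π)⟫ = ⟪X (x, 0), pd2 f (x, 0)⟫ := fun x => by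
    have h1 := hXper x 0
    have h2 := pd2_periodic hfper x 0
    rw [zero_add] at h1 h2
    rw [h1, h2]
  simp only [hb, sub_self, zero_add] at h
  exact h

lemma hasDerivAt_max_zero_sq (u : ℝ) :
    HasDerivAt (fun u : ℝ => (max 0 u) ^ 2) (2 * max 0 u) u := by
  rcases lt_trichotomy u 0 with hu | rfl | hu
  · rw [max_eq_left hu.le, mul_zero]
    refine (hasDerivAt_const u (0 : ℝ)).congr_of_eventuallyEq ?_
    filter_upwards [Iio_mem_nhds hu] with x hx
    rw [max_eq_left (le_of_lt hx)]; norm_num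
  · rw [max_self, mul_zero, hasDerivAt_iff_isLittleO]
    have h : (fun x : ℝ => x ^ 2) =o[nhds 0] fun x : ℝ => x := by
      simpa using Asymptotics.isLittleO_pow_pow (𝕜 := ℝ) (show 1 < 2 by norm_num)
    refine (Asymptotics.IsBigO.of_norm_le fun x => ?_ :
      (fun x : ℝ => (max 0 x) ^ 2 - (max 0 (0 : ℝ)) ^ 2 - (x - 0) • (0 : ℝ)) =O[nhds 0]
        fun x : ℝ => x ^ 2).trans_isLittleO (by simpa using h)
    rcases le_total 0 x with hx | hx <;> simp [hx, sq_nonneg]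
  · rw [max_eq_right hu.le]
    have h : HasDerivAt (fun x : ℝ => x ^ 2) (2 * u) u := by simpa using hasDerivAt_pow 2 u
    refine h.congr_of_eventuallyEq ?_
    filter_upwards [Ioi_mem_nhds hu] with x hx
    rw [max_eq_right (le_of_lt hx)]

lemma contDiff_max_zero_sq : ContDiff ℝ 1 fun u : ℝ => (max 0 u) ^ 2 := by
  rw [contDiff_one_iff_deriv]
  refine ⟨fun u => (hasDerivAt_max_zero_sq u).differentiableAt, ?_⟩
  rw [show deriv (fun u : ℝ => (max 0 u) ^ 2) = fun u => 2 * max 0 u from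
    funext fun u => (hasDerivAt_max_zero_sq u).deriv]
  fun_prop

/-- Truncation of `1 / y` at the level `Y`, used as a weight in the monotonicity formula. -/
noncomputable def cutoff (Y y : ℝ) : ℝ := y⁻¹ * (max 0 (1 - y / Y)) ^ 2

/-- The negative of the derivative of `cutoff Y`. -/
noncomputable def cutoffSlope (Y y : ℝ) : ℝ :=
  max 0 (1 - y / Y) * (max 0 (1 - y / Y) / y ^ 2 + 2 / (y * Y))

lemma hasDerivAt_cutoff (Y : ℝ) {y : ℝ} (hy : 0 < y) :
    HasDerivAt (cutoff Y) (-cutoffSlope Y y) y := by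
  have h1 : HasDerivAt (fun y : ℝ => 1 - y / Y) (-(1 / Y)) y := by
    simpa using ((hasDerivAt_id y).div_const Y).const_sub 1
  have h := (hasDerivAt_inv hy.ne').mul ((hasDerivAt_max_zero_sq (1 - y / Y)).comp y h1)
  refine h.congr_deriv ?_
  simp only [cutoffSlope, Function.comp_apply]
  by_cases hY : Y = 0
  · subst hY
    simp
  · field_simp
    ring

lemma cutoff_sq_le {Y y : ℝ} (hY : 0 < Y) (hy : 0 < y) : cutoff Y y ^ 2 ≤ cutoffSlope Y y := by
  unfold cutoff cutoffSlope
  set u := max 0 (1 - y / Y)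
  have hu0 : 0 ≤ u := le_max_left _ _
  have hu1 : u ≤ 1 := max_le zero_le_one (by have : 0 ≤ y / Y := by positivity
                                             linarith)
  have h1 : u ^ 4 ≤ u ^ 2 := pow_le_pow_of_le_one hu0 hu1 (by norm_num)
  calc (y⁻¹ * u ^ 2) ^ 2 = u ^ 4 / y ^ 2 := by field_simp
    _ ≤ u ^ 2 / y ^ 2 := by gcongr
    _ ≤ u * (u / y ^ 2 + 2 / (y * Y)) := by
      have : 0 ≤ u * (2 / (y * Y)) := by positivity
      rw [mul_add, ← mul_div_assoc, ← sq]
      linarith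

lemma cutoff_sub_mul_cutoffSlope {Y y : ℝ} (hY : 0 < Y) (hy : 0 < y) :
    -(4 / Y) ≤ 2 * cutoff Y y - 2 * y * cutoffSlope Y y := by
  unfold cutoff cutoffSlope
  set u := max 0 (1 - y / Y)
  have hu1 : u ≤ 1 := max_le zero_le_one (by have : 0 ≤ y / Y := by positivity
                                             linarith)
  have : 2 * (y⁻¹ * u ^ 2) - 2 * y * (u * (u / y ^ 2 + 2 / (y * Y))) = -(4 / Y) * u := by
    field_simp
    ring
  rw [this]
  have : 0 < 4 / Y := by positivity
  nlinarith

lemma cutoffSlope_nonneg {Y y : ℝ} (hY : 0 < Y) (hy : 0 < y) : 0 ≤ cutoffSlope Y y :=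
  (sq_nonneg _).trans (cutoff_sq_le hY hy)

lemma continuousOn_cutoffSlope {Y : ℝ} (hY : 0 < Y) : ContinuousOn (cutoffSlope Y) (Ioi 0) := by
  unfold cutoffSlope
  have h : ∀ y ∈ Ioi (0 : ℝ), y ^ 2 ≠ 0 := fun y hy => pow_ne_zero _ (ne_of_gt hy)
  have h' : ∀ y ∈ Ioi (0 : ℝ), y * Y ≠ 0 := fun y hy => mul_ne_zero (ne_of_gt hy) hY.ne'
  fun_prop (disch := assumption)

/-- Pointwise estimate behind the monotonicity formula: `v`, `w` are the partial derivatives of a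
conformal map, `L` is its (normal) Laplacian and `q` its position vector. -/
lemma monotonicity_pointwise {v w L q : EuclideanSpace ℝ (Fin n)} (hvw : ‖v‖ ^ 2 = ‖w‖ ^ 2)
    (hvw0 : ⟪v, w⟫ = 0) (hLv : ⟪L, v⟫ = 0) (hLw : ⟪L, w⟫ = 0) (hL : v = 0 → L = 0)
    {σ Y ψ ψ' : ℝ} (hψ : ψ ^ 2 ≤ ψ')
    (hψ' : -(4 / Y) ≤ 2 * ψ - 2 * (‖q‖ ^ 2 + σ ^ 2) * ψ') :
    -(2 / Y) * (‖v‖ ^ 2 + ‖w‖ ^ 2) + σ ^ 2 * ψ' * (‖v‖ ^ 2 + ‖w‖ ^ 2)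
        - 1 / 4 * (‖L‖ ^ 2 / (‖v‖ ^ 2 + ‖w‖ ^ 2)) ≤
      ⟪ψ • v - (ψ' * (2 * ⟪q, v⟫)) • q, v⟫ + ⟪ψ • w - (ψ' * (2 * ⟪q, w⟫)) • q, w⟫ +
        ⟪ψ • q, L⟫ := by
  by_cases hv : v = 0
  · have hw : w = 0 := by
      rw [hv, norm_zero] at hvw
      simpa using hvw.symm
    simp [hv, hw, hL hv]
  have hlam : 0 < ‖v‖ ^ 2 := by positivity
  set lam := ‖v‖ ^ 2 with hlamdef
  rw [← hvw]
  set α := ⟪q, v⟫ with hα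
  set β := ⟪q, w⟫ with hβ
  set P := ⟪q, L⟫ with hP
  set B := lam * ‖q‖ ^ 2 - α ^ 2 - β ^ 2 with hB
  set H := ‖L‖ ^ 2 / (lam + lam) with hH
  have hH0 : 0 ≤ H := by positivity
  have hvv : ⟪v, v⟫ = lam := real_inner_self_eq_norm_sq v
  have hww : ⟪w, w⟫ = lam := by rw [real_inner_self_eq_norm_sq, ← hvw]
  have hwv0 : ⟪w, v⟫ = 0 := by rw [real_inner_comm]; exact hvw0
  have hnorm : ‖lam • q - α • v - β • w‖ ^ 2 = lam * B := by
    rw [← real_inner_self_eq_norm_sq]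
    simp only [inner_sub_left, inner_sub_right, inner_smul_left, inner_smul_right, hvv, hww, hvw0,
      hwv0, real_inner_comm q v, real_inner_comm q w, real_inner_self_eq_norm_sq, conj_trivial,
      ← hα, ← hβ, hB]
    ring
  have hB0 : 0 ≤ B := by
    have : 0 ≤ lam * B := hnorm ▸ sq_nonneg _
    exact nonneg_of_mul_nonneg_right this hlam
  have hin : ⟪lam • q - α • v - β • w, L⟫ = lam * P := by
    simp only [inner_sub_left, inner_smul_left, real_inner_comm L v, real_inner_comm L w, hLv, hLw,
      conj_trivial, ← hP]
    ring
  have hcs : P ^ 2 ≤ 2 * H * B := by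
    have h1 := abs_real_inner_le_norm (lam • q - α • v - β • w) L
    have h2 := pow_le_pow_left₀ (abs_nonneg _) h1 2
    rw [sq_abs, hin, mul_pow, mul_pow, hnorm] at h2
    have h3 : ‖L‖ ^ 2 = 2 * lam * H := by rw [hH]; field_simp; ring
    rw [h3] at h2
    have h4 : lam ^ 2 * P ^ 2 ≤ lam ^ 2 * (2 * H * B) := by linarith
    exact le_of_mul_le_mul_left h4 (by positivity)
  have hcross : -(2 * ψ ^ 2 * B + H / 4) ≤ ψ * P := by
    refine (abs_le_of_sq_le_sq' ?_ (by positivity)).1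
    have h1 : (ψ * P) ^ 2 ≤ ψ ^ 2 * (2 * H * B) := by
      rw [mul_pow]; gcongr
    nlinarith [sq_nonneg (2 * ψ ^ 2 * B - H / 4)]
  have hS : ⟪ψ • v - (ψ' * (2 * α)) • q, v⟫ + ⟪ψ • w - (ψ' * (2 * β)) • q, w⟫ + ⟪ψ • q, L⟫ =
      2 * lam * ψ - 2 * ψ' * (lam * ‖q‖ ^ 2 - B) + ψ * P := by
    simp only [inner_sub_left, inner_smul_left, hvv, hww, conj_trivial, ← hα, ← hβ, ← hP, hB]
    ring
  rw [hS]
  have h5 := mul_le_mul_of_nonneg_left hψ' hlam.le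
  have h6 := mul_le_mul_of_nonneg_right hψ hB0
  have h7 : lam * -(4 / Y) = -(2 / Y) * (lam + lam) := by ring
  rw [h7] at h5
  nlinarith

/-- The integrated form of the monotonicity formula, for a conformal map whose boundary circles avoid
the ball of radius `ρ` around `p`. -/
lemma monotonicity_integral (hf : ContDiff ℝ 2 f)
    (hper : ∀ t θ : ℝ, f (t, θ + 2 * π) = f (t, θ))
    (hconf : ∀ z, ‖pd1 f z‖ ^ 2 = ‖pd2 f z‖ ^ 2 ∧ ⟪pd1 f z, pd2 f z⟫ = 0)
    (hlap : ∀ z, gradSq f z = 0 → lap f z = 0) {a b : ℝ} (hab : a ≤ b)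
    {p : EuclideanSpace ℝ (Fin n)} {ρ σ : ℝ} (hρ : 0 < ρ) (hσpos : 0 < σ)
    (ha : ∀ θ, ρ ≤ ‖f (a, θ) - p‖) (hb : ∀ θ, ρ ≤ ‖f (b, θ) - p‖)
    (hH : IntegrableOn (fun z => ‖lap f z‖ ^ 2 / gradSq f z) (band a b)) :
    ∫ z in band a b,
        σ ^ 2 * cutoffSlope (ρ ^ 2 + σ ^ 2) (‖f z - p‖ ^ 2 + σ ^ 2) * gradSq f z ≤
      2 / ρ ^ 2 * (∫ z in band a b, gradSq f z) +
        1 / 4 * ∫ z in band a b, ‖lap f z‖ ^ 2 / gradSq f z := by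
  have hdf : Differentiable ℝ f := hf.differentiable (by norm_num)
  have hgc : Continuous (gradSq f) := continuous_gradSq (hf.of_le (by norm_num))
  set Y := ρ ^ 2 + σ ^ 2 with hY
  have hYpos : 0 < Y := by positivity
  set y : ℝ × ℝ → ℝ := fun z => ‖f z - p‖ ^ 2 + σ ^ 2 with hy
  have hypos : ∀ z, 0 < y z := fun z => by positivity
  have hqC : ContDiff ℝ 2 fun z => f z - p := hf.sub contDiff_const
  have hyC : ContDiff ℝ 1 y := ((hqC.norm_sq ℝ).of_le (by norm_num)).add contDiff_const
  -- the test field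
  set X : ℝ × ℝ → EuclideanSpace ℝ (Fin n) := fun z => cutoff Y (y z) • (f z - p) with hX
  have hXC : ContDiff ℝ 1 X := by
    refine ContDiff.smul (ContDiff.mul (hyC.inv fun z => (hypos z).ne') ?_)
      (hqC.of_le (by norm_num))
    exact contDiff_max_zero_sq.comp (contDiff_const.sub (hyC.div_const Y))
  have hXper : ∀ t θ : ℝ, X (t, θ + 2 * π) = X (t, θ) := fun t θ => by
    simp only [hX, hy, hper]
  have hXD : ∀ z e, fderiv ℝ X z e = cutoff Y (y z) • fderiv ℝ f z e -
      (cutoffSlope Y (y z) * (2 * ⟪f z - p, fderiv ℝ f z e⟫)) • (f z - p) := by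
    intro z e
    have hq : HasFDerivAt (fun z => f z - p) (fderiv ℝ f z) z :=
      (hdf z).hasFDerivAt.sub_const _
    have hyd := (hq.norm_sq.add_const (σ ^ 2))
    have h := ((hasDerivAt_cutoff Y (hypos z)).comp_hasFDerivAt z hyd).smul hq
    rw [HasFDerivAt.fderiv (f := X) h]
    change cutoff Y (y z) • fderiv ℝ f z e + (-cutoffSlope Y (y z) *
      ((2 : ℕ) • ⟪f z - p, fderiv ℝ f z e⟫)) • (f z - p) = _
    rw [two_nsmul]
    module
  have hX0 : ∀ z, ρ ≤ ‖f z - p‖ → X z = 0 := by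
    intro z hz
    have : 1 ≤ y z / Y := by
      rw [one_le_div hYpos]
      simp only [hy, hY]
      gcongr
    simp only [hX, cutoff]
    rw [max_eq_left (by linarith)]
    simp
  have hgreen := green_band hf hXC hper hXper hab
  simp only [hX0 _ (ha _), hX0 _ (hb _), inner_zero_left, intervalIntegral.integral_zero,
    sub_self] at hgreen
  have hpt : ∀ z, -(2 / Y) * gradSq f z + σ ^ 2 * cutoffSlope Y (y z) * gradSq f z
      - 1 / 4 * (‖lap f z‖ ^ 2 / gradSq f z) ≤
      ⟪pd1 X z, pd1 f z⟫ + ⟪pd2 X z, pd2 f z⟫ + ⟪X z, lap f z⟫ := by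
    intro z
    rw [pd1, pd2, hXD, hXD]
    have hN := inner_lap_of_conformal hf hconf z
    refine monotonicity_pointwise (hconf z).1 (hconf z).2 hN.1 hN.2 (fun h => hlap z ?_)
      (cutoff_sq_le hYpos (hypos z)) (cutoff_sub_mul_cutoffSlope hYpos (hypos z))
    rw [gradSq, ← (hconf z).1, h]; simp
  have hsc : Continuous fun z => σ ^ 2 * cutoffSlope Y (y z) * gradSq f z := by
    have : Continuous fun z => cutoffSlope Y (y z) :=
      (continuousOn_cutoffSlope hYpos).comp_continuous hyC.continuous hypos
    fun_prop
  have i1 : IntegrableOn (fun z => -(2 / Y) * gradSq f z) (band a b) :=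
    (hgc.integrableOn_band a b).const_mul _
  have i2 := hsc.integrableOn_band a b
  have i3 := hH.const_mul (1 / 4)
  have hcS : Continuous fun z => ⟪pd1 X z, pd1 f z⟫ + ⟪pd2 X z, pd2 f z⟫ + ⟪X z, lap f z⟫ := by
    have := hXC.continuous
    have := (hXC.pd1 (m := 0) (by norm_num)).continuous
    have := (hXC.pd2 (m := 0) (by norm_num)).continuous
    have := (hf.pd1 (m := 0) (by norm_num)).continuous
    have := (hf.pd2 (m := 0) (by norm_num)).continuous
    have := continuous_lap hf
    fun_prop
  have hmono := integral_mono (μ := volume.restrict (band a b)) ((i1.add i2).sub i3)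
    (hcS.integrableOn_band a b) hpt
  rw [hgreen] at hmono
  rw [integral_sub' (i1.add i2) i3, integral_add' i1 i2, integral_const_mul, integral_const_mul]
    at hmono
  have hE : 0 ≤ ∫ z in band a b, gradSq f z := integral_nonneg fun z => gradSq_nonneg z
  have hYρ : 2 / Y * (∫ z in band a b, gradSq f z) ≤
      2 / ρ ^ 2 * ∫ z in band a b, gradSq f z := by
    gcongr
    simp only [hY]
    nlinarith
  linarith

/-- Lower area bound for conformal maps of small Willmore energy: if the image of the two boundary
circles avoids the ball of radius `ρ` around `f z₀`, then the area of the band is bounded from below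
by a multiple of `ρ ^ 2`. -/
lemma area_lower_bound (hf : ContDiff ℝ 2 f)
    (hper : ∀ t θ : ℝ, f (t, θ + 2 * π) = f (t, θ))
    (hconf : ∀ z, ‖pd1 f z‖ ^ 2 = ‖pd2 f z‖ ^ 2 ∧ ⟪pd1 f z, pd2 f z⟫ = 0)
    (hlap : ∀ z, gradSq f z = 0 → lap f z = 0) {a b : ℝ} {z₀ : ℝ × ℝ}
    (hz₀ : z₀ ∈ Ioo a b ×ˢ Ioo 0 (2 * π)) (hne : gradSq f z₀ ≠ 0) {ρ : ℝ} (hρ : 0 < ρ)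
    (ha : ∀ θ, ρ ≤ ‖f (a, θ) - f z₀‖) (hb : ∀ θ, ρ ≤ ‖f (b, θ) - f z₀‖)
    (hH : IntegrableOn (fun z => ‖lap f z‖ ^ 2 / gradSq f z) (band a b)) :
    1 / 36 ≤ 2 / ρ ^ 2 * (∫ z in band a b, gradSq f z) +
      1 / 4 * ∫ z in band a b, ‖lap f z‖ ^ 2 / gradSq f z := by
  have hab : a ≤ b := (hz₀.1.1.trans hz₀.1.2).le
  have hdf : Differentiable ℝ f := hf.differentiable (by norm_num)
  have hgc : Continuous (gradSq f) := continuous_gradSq (hf.of_le (by norm_num))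
  set g₀ := gradSq f z₀ with hg₀
  have hg₀pos : 0 < g₀ := lt_of_le_of_ne (gradSq_nonneg _) (Ne.symm hne)
  set s₀ := ‖pd1 f z₀‖ with hs₀
  have hs₀sq : g₀ = 2 * s₀ ^ 2 := by rw [hg₀, gradSq, ← (hconf z₀).1]; ring
  have hs₀pos : 0 < s₀ := by
    rcases (norm_nonneg (pd1 f z₀)).lt_or_eq with h | h
    · exact h
    · rw [hs₀sq, hs₀, ← h] at hg₀pos; norm_num at hg₀pos
  have hpd2 : ‖pd2 f z₀‖ = s₀ := by
    have := (hconf z₀).1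
    exact ((sq_eq_sq₀ (norm_nonneg _) (norm_nonneg _)).1 this).symm
  -- the behaviour of `f` near `z₀`
  have hlip : ∀ᶠ z in nhds z₀, ‖f z - f z₀‖ ≤ 3 * s₀ * ‖z - z₀‖ := by
    have h := (hdf z₀).hasFDerivAt.isLittleO.def hs₀pos
    filter_upwards [h] with z hz
    have h1 : fderiv ℝ f z₀ (z - z₀) = (z - z₀).1 • pd1 f z₀ + (z - z₀).2 • pd2 f z₀ := by
      rw [pd1, pd2, ← map_smul, ← map_smul, ← map_add]
      congr 1
      ext <;> simp
    have h2 : ‖fderiv ℝ f z₀ (z - z₀)‖ ≤ 2 * s₀ * ‖z - z₀‖ := by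
      rw [h1]
      refine (norm_add_le _ _).trans ?_
      rw [norm_smul, norm_smul, hpd2, ← hs₀]
      have := norm_fst_le (z - z₀)
      have := norm_snd_le (z - z₀)
      nlinarith
    calc ‖f z - f z₀‖ = ‖(f z - f z₀ - fderiv ℝ f z₀ (z - z₀)) + fderiv ℝ f z₀ (z - z₀)‖ := by
          rw [sub_add_cancel]
      _ ≤ s₀ * ‖z - z₀‖ + 2 * s₀ * ‖z - z₀‖ := (norm_add_le _ _).trans (add_le_add hz h2)
      _ = 3 * s₀ * ‖z - z₀‖ := by ring
  have hgrad : ∀ᶠ z in nhds z₀, g₀ / 2 ≤ gradSq f z :=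
    (hgc.continuousAt.eventually (lt_mem_nhds (half_lt_self hg₀pos))).mono fun _ h => h.le
  have hin : ∀ᶠ z in nhds z₀, z ∈ band a b :=
    (mem_of_superset ((isOpen_Ioo.prod isOpen_Ioo).mem_nhds hz₀)
      (prod_mono Ioo_subset_Icc_self Ioo_subset_Icc_self))
  obtain ⟨δ₀, hδ₀, hball⟩ := Metric.eventually_nhds_iff_ball.1 (hlip.and (hgrad.and hin))
  obtain ⟨δ, hδ, hδδ₀, hδρ⟩ : ∃ δ > 0, δ < δ₀ ∧ 3 * s₀ * δ ≤ ρ / 2 := by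
    refine ⟨min (δ₀ / 2) (ρ / (6 * s₀)), by positivity,
      (min_le_left _ _).trans_lt (by linarith), ?_⟩
    calc 3 * s₀ * min (δ₀ / 2) (ρ / (6 * s₀)) ≤ 3 * s₀ * (ρ / (6 * s₀)) := by
          gcongr; exact min_le_right _ _
      _ = ρ / 2 := by field_simp; norm_num
  set σ := 3 * s₀ * δ with hσ
  have hσpos : 0 < σ := by positivity
  set Y := ρ ^ 2 + σ ^ 2 with hY
  have hYpos : 0 < Y := by positivity
  set y : ℝ × ℝ → ℝ := fun z => ‖f z - f z₀‖ ^ 2 + σ ^ 2 with hy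
  have hypos : ∀ z, 0 < y z := fun z => by positivity
  refine le_trans ?_ (monotonicity_integral hf hper hconf hlap hab hρ hσpos ha hb hH)
  change 1 / 36 ≤ ∫ z in band a b, σ ^ 2 * cutoffSlope Y (y z) * gradSq f z
  have hsc : Continuous fun z => σ ^ 2 * cutoffSlope Y (y z) * gradSq f z := by
    have hyc : Continuous y := by
      have := hf.continuous
      fun_prop
    have : Continuous fun z => cutoffSlope Y (y z) :=
      (continuousOn_cutoffSlope hYpos).comp_continuous hyc hypos
    fun_prop
  -- the contribution of a small square around `z₀`
  have hsub : Metric.closedBall z₀ δ ⊆ Metric.ball z₀ δ₀ := Metric.closedBall_subset_ball hδδ₀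
  have hvol : volume.real (Metric.closedBall z₀ δ) = (2 * δ) ^ 2 := by
    obtain ⟨p, r⟩ := z₀
    rw [← closedBall_prod_same, Measure.volume_eq_prod, measureReal_prod_prod,
      Real.volume_real_closedBall hδ.le, Real.volume_real_closedBall hδ.le]
    ring
  have hlow : ∀ z ∈ Metric.closedBall z₀ δ,
      g₀ / (32 * σ ^ 2) ≤ σ ^ 2 * cutoffSlope Y (y z) * gradSq f z := by
    intro z hz
    obtain ⟨h1, h2, -⟩ := hball z (hsub hz)
    have hzσ : ‖f z - f z₀‖ ≤ σ := h1.trans (by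
      rw [hσ, ← dist_eq_norm]
      gcongr
      exact hz)
    have hy2 : y z ≤ 2 * σ ^ 2 := by
      simp only [hy]
      have := pow_le_pow_left₀ (norm_nonneg _) hzσ 2
      linarith
    have hyY : y z / Y ≤ 1 / 2 := by
      rw [div_le_iff₀ hYpos]
      have := pow_le_pow_left₀ hσpos.le hδρ 2
      simp only [hY]
      nlinarith
    have hslope : 1 / (16 * σ ^ 4) ≤ cutoffSlope Y (y z) := by
      have hu : 1 / 2 ≤ max 0 (1 - y z / Y) := le_max_of_le_right (by linarith)
      have hyz := hypos z
      calc 1 / (16 * σ ^ 4) = 1 / 2 * ((1 / 2) / (2 * σ ^ 2) ^ 2 + 0) := by field_simp; norm_num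
        _ ≤ cutoffSlope Y (y z) := by
          unfold cutoffSlope
          gcongr
          positivity
    calc g₀ / (32 * σ ^ 2) = σ ^ 2 * (1 / (16 * σ ^ 4)) * (g₀ / 2) := by field_simp; norm_num
      _ ≤ _ := by
        have := cutoffSlope_nonneg hYpos (hypos z)
        gcongr
  have h1 := setIntegral_ge_of_const_le_real (μ := volume) Metric.isClosed_closedBall.measurableSet
    (isCompact_closedBall z₀ δ).measure_ne_top hlow
    (hsc.continuousOn.integrableOn_compact (isCompact_closedBall z₀ δ))
  have h2 : ∫ z in Metric.closedBall z₀ δ, σ ^ 2 * cutoffSlope Y (y z) * gradSq f z ≤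
      ∫ z in band a b, σ ^ 2 * cutoffSlope Y (y z) * gradSq f z := by
    refine setIntegral_mono_set (hsc.integrableOn_band a b) (ae_of_all _ fun z => ?_)
      (LE.le.eventuallyLE fun z hz => (hball z (hsub hz)).2.2)
    have := cutoffSlope_nonneg hYpos (hypos z)
    have := gradSq_nonneg (f := f) z
    simp only [Pi.zero_apply]
    positivity
  rw [hvol] at h1
  refine le_trans (le_of_eq ?_) (h1.trans h2)
  rw [hs₀sq, hσ]
  field_simp
  norm_num

/-- The mean of a map over the circle `{t} × [0, 2π]`. -/
noncomputable def circleMean (f : ℝ × ℝ → EuclideanSpace ℝ (Fin n)) (t : ℝ) :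
    EuclideanSpace ℝ (Fin n) :=
  (2 * π)⁻¹ • ∫ θ in (0 : ℝ)..2 * π, f (t, θ)

lemma two_pi_smul_circleMean (t : ℝ) :
    (2 * π) • circleMean f t = ∫ θ in (0 : ℝ)..2 * π, f (t, θ) := by
  rw [circleMean, smul_smul, mul_inv_cancel₀ (by positivity), one_smul]

lemma continuous_circleMean (hf : Continuous f) : Continuous (circleMean f) :=
  (continuous_slice_integral hf).const_smul (2 * π)⁻¹

lemma hasDerivAt_circleMean (hf : ContDiff ℝ 1 f) (t : ℝ) :
    HasDerivAt (circleMean f) (circleMean (pd1 f) t) t := by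
  have hd : Differentiable ℝ f := hf.differentiable (by norm_num)
  have hc : Continuous (pd1 f) := (hf.pd1 (m := 0) (by norm_num)).continuous
  have hs : ∀ t, ∫ θ in (0 : ℝ)..2 * π, f (t, θ) = (∫ θ in (0 : ℝ)..2 * π, f (0, θ)) +
      ∫ s in (0 : ℝ)..t, ∫ θ in (0 : ℝ)..2 * π, pd1 f (s, θ) := by
    intro t
    have hint : ∀ t, IntervalIntegrable (fun θ => f (t, θ)) volume 0 (2 * π) := fun t =>
      (by have := hf.continuous; fun_prop : Continuous fun θ => f (t, θ)).intervalIntegrable _ _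
    rw [MeasureTheory.intervalIntegral_intervalIntegral_swap, ← sub_eq_iff_eq_add',
      ← intervalIntegral.integral_sub (hint _) (hint _)]
    · refine intervalIntegral.integral_congr fun θ _ => ?_
      exact (intervalIntegral.integral_eq_sub_of_hasDerivAt
        (fun s _ => hasDerivAt_pd1 hd s θ)
        ((by fun_prop : Continuous fun s => pd1 f (s, θ)).intervalIntegrable _ _)).symm
    · exact (hc.continuousOn.integrableOn_compact
        (isCompact_uIcc.prod isCompact_uIcc)).mono_set
          (prod_mono uIoc_subset_uIcc uIoc_subset_uIcc)
  have h : HasDerivAt (fun t => ∫ θ in (0 : ℝ)..2 * π, f (t, θ))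
      (∫ θ in (0 : ℝ)..2 * π, pd1 f (t, θ)) t := by
    rw [funext hs]
    exact ((continuous_slice_integral hc).integral_hasStrictDerivAt 0 t).hasDerivAt.const_add _
  exact h.const_smul (2 * π)⁻¹

lemma contDiff_circleMean (hf : ContDiff ℝ 1 f) : ContDiff ℝ 1 (circleMean f) := by
  rw [contDiff_one_iff_deriv]
  refine ⟨fun t => (hasDerivAt_circleMean hf t).differentiableAt, ?_⟩
  rw [funext fun t => (hasDerivAt_circleMean hf t).deriv]
  exact continuous_circleMean (hf.pd1 (m := 0) (by norm_num)).continuous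

lemma two_pi_mul_norm_circleMean_sq_le (hf : Continuous f) (t : ℝ) :
    2 * π * ‖circleMean f t‖ ^ 2 ≤ ∫ θ in (0 : ℝ)..2 * π, ‖f (t, θ)‖ ^ 2 := by
  have hpi : (0 : ℝ) ≤ 2 * π := by positivity
  set c := ‖circleMean f t‖
  have h1 : 2 * π * c ≤ ∫ θ in (0 : ℝ)..2 * π, ‖f (t, θ)‖ := by
    rw [← Real.norm_of_nonneg hpi, ← norm_smul, two_pi_smul_circleMean, Real.norm_of_nonneg hpi]
    exact intervalIntegral.norm_integral_le_integral_norm hpi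
  have h2 : ∫ θ in (0 : ℝ)..2 * π, (2 * c * ‖f (t, θ)‖ - c ^ 2) ≤
      ∫ θ in (0 : ℝ)..2 * π, ‖f (t, θ)‖ ^ 2 := by
    refine intervalIntegral.integral_mono_on hpi ?_ ?_ fun θ _ => ?_
    · exact (by fun_prop : Continuous fun θ => 2 * c * ‖f (t, θ)‖ - c ^ 2).intervalIntegrable _ _
    · exact (by fun_prop : Continuous fun θ => ‖f (t, θ)‖ ^ 2).intervalIntegrable _ _
    · nlinarith [sq_nonneg (‖f (t, θ)‖ - c)]
  rw [intervalIntegral.integral_sub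
      ((by fun_prop : Continuous fun θ => 2 * c * ‖f (t, θ)‖).intervalIntegrable _ _)
      intervalIntegrable_const,
    intervalIntegral.integral_const_mul, intervalIntegral.integral_const, smul_eq_mul,
    sub_zero] at h2
  nlinarith [mul_le_mul_of_nonneg_left h1 (norm_nonneg (circleMean f t))]

/-- A function with small derivative in `L²` oscillates little. -/
lemma norm_sub_le_of_integral_sq_le {u v : ℝ → EuclideanSpace ℝ (Fin n)}
    (hu : ∀ x, HasDerivAt u (v x) x) (hv : Continuous v) {A B x y c e : ℝ}
    (hx : x ∈ Icc A B) (hy : y ∈ Icc A B) (hc : ∫ s in A..B, ‖v s‖ ^ 2 ≤ c) (he : 0 < e) :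
    ‖u x - u y‖ ≤ 1 / 2 * ((B - A) * e + c / e) := by
  have hAB : A ≤ B := hx.1.trans hx.2
  rw [← intervalIntegral.integral_eq_sub_of_hasDerivAt (fun s _ => hu s)
    (hv.intervalIntegrable _ _)]
  have h1 : ∫ s in A..B, ‖v s‖ ≤ ∫ s in A..B, 1 / 2 * (e + ‖v s‖ ^ 2 / e) := by
    refine intervalIntegral.integral_mono_on hAB (hv.norm.intervalIntegrable _ _) ?_ fun s _ => ?_
    · exact (by fun_prop : Continuous fun s => 1 / 2 * (e + ‖v s‖ ^ 2 / e)).intervalIntegrable _ _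
    · rw [← sub_nonneg]
      have : 1 / 2 * (e + ‖v s‖ ^ 2 / e) - ‖v s‖ = (e - ‖v s‖) ^ 2 / (2 * e) := by
        field_simp; ring
      rw [this]; positivity
  rw [intervalIntegral.integral_const_mul, intervalIntegral.integral_add intervalIntegrable_const
    ((by fun_prop : Continuous fun s => ‖v s‖ ^ 2 / e).intervalIntegrable _ _),
    intervalIntegral.integral_const, intervalIntegral.integral_div, smul_eq_mul] at h1
  have h2 : ‖∫ s in y..x, v s‖ ≤ ∫ s in A..B, ‖v s‖ := by
    refine (intervalIntegral.norm_integral_le_abs_integral_norm).trans ?_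
    rw [← abs_of_nonneg (intervalIntegral.integral_nonneg hAB fun s _ => norm_nonneg (v s))]
    refine intervalIntegral.abs_integral_mono_interval ?_ (ae_of_all _ fun s => norm_nonneg _)
      (hv.norm.intervalIntegrable _ _)
    rw [uIoc_of_le hAB]
    exact Ioc_subset_Ioc (le_min hy.1 hx.1) (max_le hy.2 hx.2)
  have h3 := div_le_div_of_nonneg_right hc he.le
  linarith

lemma exists_slice_integral_le {u : ℝ × ℝ → ℝ} (hu : Continuous u) {a c : ℝ}
    (h : ∫ z in band a (a + 1), u z ≤ c) :
    ∃ t ∈ Icc a (a + 1), ∫ θ in (0 : ℝ)..2 * π, u (t, θ) ≤ c := by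
  obtain ⟨t, ht, he⟩ := exists_eq_interval_average (a := a) (b := a + 1) (by simp)
    (continuous_slice_integral hu).continuousOn
  rw [uIoo_of_le (by simp)] at ht
  refine ⟨t, Ioo_subset_Icc_self ht, ?_⟩
  rw [he, interval_average_eq, add_sub_cancel_left, inv_one, one_smul,
    ← integral_band hu (by simp)]
  exact h

lemma integral_gradSq_slice_eq (hconf : ∀ z, ‖pd1 f z‖ ^ 2 = ‖pd2 f z‖ ^ 2) (t : ℝ) :
    ∫ θ in (0 : ℝ)..2 * π, gradSq f (t, θ) = 2 * ∫ θ in (0 : ℝ)..2 * π, ‖pd2 f (t, θ)‖ ^ 2 := by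
  rw [← intervalIntegral.integral_const_mul]
  refine intervalIntegral.integral_congr fun θ _ => ?_
  simp only [gradSq, hconf]
  ring

lemma norm_circleMean_sub_le (hf : Continuous f) {t c : ℝ} {y : EuclideanSpace ℝ (Fin n)}
    (h : ∀ θ ∈ Icc 0 (2 * π), ‖f (t, θ) - y‖ ≤ c) : ‖circleMean f t - y‖ ≤ c := by
  have hpi : 0 < 2 * π := by positivity
  have h1 : (2 * π) • (circleMean f t - y) = ∫ θ in (0 : ℝ)..2 * π, (f (t, θ) - y) := by
    rw [smul_sub, two_pi_smul_circleMean, intervalIntegral.integral_sub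
      ((by fun_prop : Continuous fun θ => f (t, θ)).intervalIntegrable _ _)
      intervalIntegrable_const, intervalIntegral.integral_const, sub_zero]
  have h2 := intervalIntegral.norm_integral_le_of_norm_le_const (a := 0) (b := 2 * π)
    (f := fun θ => f (t, θ) - y) (C := c) fun θ hθ => by
      rw [uIoc_of_le hpi.le] at hθ
      exact h θ (Ioc_subset_Icc_self hθ)
  rw [← h1, norm_smul, Real.norm_of_nonneg hpi.le, sub_zero, abs_of_pos hpi, mul_comm c] at h2
  exact le_of_mul_le_mul_left h2 hpi

lemma norm_sub_circleMean_le (hf : ContDiff ℝ 1 f)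
    (hper : ∀ t θ : ℝ, f (t, θ + 2 * π) = f (t, θ))
    (hconf : ∀ z, ‖pd1 f z‖ ^ 2 = ‖pd2 f z‖ ^ 2) {t e : ℝ} (he : 0 < e)
    (h : ∫ θ in (0 : ℝ)..2 * π, gradSq f (t, θ) ≤ e ^ 2) (θ : ℝ) :
    ‖f (t, θ) - circleMean f t‖ ≤ 4 * e := by
  have hd : Differentiable ℝ f := hf.differentiable (by norm_num)
  have hc : Continuous (pd2 f) := (hf.pd2 (m := 0) (by norm_num)).continuous
  have hp : Function.Periodic (fun θ => f (t, θ)) (2 * π) := fun θ => hper t θ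
  obtain ⟨θ', hθ', he'⟩ := hp.exists_mem_Ico₀ (by positivity) θ
  rw [he', norm_sub_rev]
  refine norm_circleMean_sub_le hf.continuous fun θ₁ hθ₁ => ?_
  rw [integral_gradSq_slice_eq hconf] at h
  have := norm_sub_le_of_integral_sq_le (hasDerivAt_pd2 hd t)
    (by fun_prop : Continuous fun θ => pd2 f (t, θ)) hθ₁ (Ico_subset_Icc_self hθ')
    (c := e ^ 2 / 2) (by linarith) he
  have e2 : e ^ 2 / 2 / e = e / 2 := by field_simp
  rw [e2] at this
  nlinarith [Real.pi_lt_d2]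

lemma integral_norm_circleMean_pd1_sq_le (hf : ContDiff ℝ 1 f)
    (hconf : ∀ z, ‖pd1 f z‖ ^ 2 = ‖pd2 f z‖ ^ 2) {a b : ℝ} (hab : a ≤ b) :
    2 * π * ∫ t in a..b, ‖circleMean (pd1 f) t‖ ^ 2 ≤ 1 / 2 * ∫ z in band a b, gradSq f z := by
  have hc : Continuous (pd1 f) := (hf.pd1 (m := 0) (by norm_num)).continuous
  have hm := continuous_circleMean hc
  rw [integral_band (continuous_gradSq hf) hab, ← intervalIntegral.integral_const_mul,
    ← intervalIntegral.integral_const_mul]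
  refine intervalIntegral.integral_mono_on hab
    ((by fun_prop : Continuous fun t => 2 * π * ‖circleMean (pd1 f) t‖ ^ 2).intervalIntegrable _ _)
    (((continuous_slice_integral (continuous_gradSq hf)).const_mul _).intervalIntegrable _ _)
    fun t _ => ?_
  refine (two_pi_mul_norm_circleMean_sq_le hc t).trans_eq ?_
  rw [integral_gradSq_slice_eq hconf]
  simp only [hconf]
  ring

lemma norm_circleMean_sub_circleMean_le (hf : ContDiff ℝ 1 f)
    (hconf : ∀ z, ‖pd1 f z‖ ^ 2 = ‖pd2 f z‖ ^ 2) {a x y e : ℝ} (he : 0 < e)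
    (hE : ∫ z in band a (a + 3), gradSq f z ≤ e ^ 2)
    (hx : x ∈ Icc a (a + 3)) (hy : y ∈ Icc a (a + 3)) :
    ‖circleMean f x - circleMean f y‖ ≤ 2 * e := by
  have hc : Continuous (pd1 f) := (hf.pd1 (m := 0) (by norm_num)).continuous
  have h1 := integral_norm_circleMean_pd1_sq_le hf hconf (show a ≤ a + 3 by linarith)
  have h0 : 0 ≤ ∫ t in a..a + 3, ‖circleMean (pd1 f) t‖ ^ 2 :=
    intervalIntegral.integral_nonneg (by linarith) fun _ _ => by positivity
  have := norm_sub_le_of_integral_sq_le (hasDerivAt_circleMean hf) (continuous_circleMean hc)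
    hx hy (c := e ^ 2) (by nlinarith [Real.pi_gt_three]) he
  have e2 : e ^ 2 / e = e := by field_simp
  rw [e2] at this
  linarith

/-- If the Willmore energy is small then the distance of `f` to its circle mean is controlled
by the Dirichlet energy. -/
lemma oscillation_bound (hf : ContDiff ℝ 2 f)
    (hper : ∀ t θ : ℝ, f (t, θ + 2 * π) = f (t, θ))
    (hconf : ∀ z, ‖pd1 f z‖ ^ 2 = ‖pd2 f z‖ ^ 2 ∧ ⟪pd1 f z, pd2 f z⟫ = 0)
    (hlap : ∀ z, gradSq f z = 0 → lap f z = 0) {s e : ℝ} (he : 0 < e)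
    (hE : ∫ z in band (s - 1) (s + 2), gradSq f z ≤ e ^ 2)
    (hH : IntegrableOn (fun z => ‖lap f z‖ ^ 2 / gradSq f z) (band (s - 1) (s + 2)))
    (hW : ∫ z in band (s - 1) (s + 2), ‖lap f z‖ ^ 2 / gradSq f z ≤ 3 / 100)
    {z₀ : ℝ × ℝ} (hz₀ : z₀ ∈ Ioo s (s + 1) ×ˢ Ioo 0 (2 * π)) (hne : gradSq f z₀ ≠ 0) :
    ‖f z₀ - circleMean f z₀.1‖ ≤ 26 * e := by
  by_contra! hcon
  have hf1 : ContDiff ℝ 1 f := hf.of_le (by norm_num)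
  have hc1 : ∀ z, ‖pd1 f z‖ ^ 2 = ‖pd2 f z‖ ^ 2 := fun z => (hconf z).1
  have hg := continuous_gradSq hf1
  have hsub : ∀ a b, s - 1 ≤ a → b ≤ s + 2 → ∫ z in band a b, gradSq f z ≤ e ^ 2 :=
    fun a b ha hb => (setIntegral_mono_set (hg.integrableOn_band _ _)
      (ae_of_all _ fun z => gradSq_nonneg z) (band_subset ha hb).eventuallyLE).trans hE
  obtain ⟨t₁, ht₁, hA₁⟩ := exists_slice_integral_le hg
    (hsub (s - 1) (s - 1 + 1) le_rfl (by linarith))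
  obtain ⟨t₂, ht₂, hA₂⟩ := exists_slice_integral_le hg
    (hsub (s + 1) (s + 1 + 1) (by linarith) (by linarith))
  obtain ⟨⟨hz1, hz2⟩, hz3⟩ := hz₀
  have hE' : ∫ z in band (s - 1) (s - 1 + 3), gradSq f z ≤ e ^ 2 :=
    hsub _ _ le_rfl (by linarith)
  have hfar : ∀ t ∈ Icc (s - 1) (s - 1 + 3), ∫ θ in (0 : ℝ)..2 * π, gradSq f (t, θ) ≤ e ^ 2 →
      ∀ θ, 20 * e ≤ ‖f (t, θ) - f z₀‖ := by
    intro t ht hA θ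
    have i1 := norm_sub_circleMean_le hf1 hper hc1 he hA θ
    have i2 := norm_circleMean_sub_circleMean_le hf1 hc1 he hE' (y := z₀.1) ht
      ⟨by linarith, by linarith⟩
    have i3 := norm_sub_le_norm_sub_add_norm_sub (f z₀) (f (t, θ)) (circleMean f z₀.1)
    have i4 := norm_sub_le_norm_sub_add_norm_sub (f (t, θ)) (circleMean f t) (circleMean f z₀.1)
    rw [norm_sub_rev (f z₀) (f (t, θ))] at i3
    linarith
  have hsub' : band t₁ t₂ ⊆ band (s - 1) (s + 2) := band_subset ht₁.1 (by linarith [ht₂.2])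
  have key := area_lower_bound hf hper hconf hlap
    (show z₀ ∈ Ioo t₁ t₂ ×ˢ Ioo 0 (2 * π) from
      ⟨⟨by linarith [ht₁.2], by linarith [ht₂.1]⟩, hz3⟩) hne (by positivity : 0 < 20 * e)
    (hfar t₁ ⟨ht₁.1, by linarith [ht₁.2]⟩ hA₁)
    (hfar t₂ ⟨by linarith [ht₂.1], by linarith [ht₂.2]⟩ hA₂) (hH.mono_set hsub')
  have k1 := hsub t₁ t₂ ht₁.1 (by linarith [ht₂.2])
  have k2 : ∫ z in band t₁ t₂, ‖lap f z‖ ^ 2 / gradSq f z ≤ 3 / 100 :=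
    (setIntegral_mono_set hH (ae_of_all _ fun z => div_nonneg (by positivity) (gradSq_nonneg z))
      hsub'.eventuallyLE).trans hW
  have k3 : 2 / (20 * e) ^ 2 * ∫ z in band t₁ t₂, gradSq f z ≤ 1 / 200 := by
    calc _ ≤ 2 / (20 * e) ^ 2 * e ^ 2 := by gcongr
      _ = 1 / 200 := by field_simp; norm_num
  linarith

lemma lintegral_eq_willmore (hf : ContDiff ℝ 1 f) (Ω : Set (ℝ × ℝ)) :
    ∫⁻ z in Ω, ENNReal.ofReal (‖lap f z‖ ^ 2 / gradSq f z) = willmore f Ω := by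
  have hm : MeasurableSet {w | gradSq f w ≠ 0} :=
    ((isClosed_singleton (x := (0 : ℝ))).preimage (continuous_gradSq hf)).measurableSet.compl
  rw [willmore, inter_comm, ← Measure.restrict_restrict hm, ← lintegral_indicator hm]
  refine lintegral_congr fun z => ?_
  by_cases hz : gradSq f z = 0 <;> simp [indicator, hz]

lemma integrableOn_and_integral_le_of_willmore_le (hf : ContDiff ℝ 2 f) {Ω : Set (ℝ × ℝ)} {c : ℝ}
    (hc : 0 ≤ c) (h : willmore f Ω ≤ ENNReal.ofReal c) :
    IntegrableOn (fun z => ‖lap f z‖ ^ 2 / gradSq f z) Ω ∧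
      ∫ z in Ω, ‖lap f z‖ ^ 2 / gradSq f z ≤ c := by
  have hf1 : ContDiff ℝ 1 f := hf.of_le (by norm_num)
  have hm : Measurable fun z => ‖lap f z‖ ^ 2 / gradSq f z :=
    ((continuous_lap hf).norm.pow 2).measurable.div (continuous_gradSq hf1).measurable
  have h0 : ∀ z, 0 ≤ ‖lap f z‖ ^ 2 / gradSq f z := fun z =>
    div_nonneg (by positivity) (gradSq_nonneg z)
  rw [← lintegral_eq_willmore hf1] at h
  constructor
  · exact (lintegral_ofReal_ne_top_iff_integrable hm.aestronglyMeasurable (ae_of_all _ h0)).1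
      (ne_top_of_le_ne_top ENNReal.ofReal_ne_top h)
  · rw [integral_eq_lintegral_of_nonneg_ae (ae_of_all _ h0) hm.aestronglyMeasurable]
    exact ENNReal.toReal_le_of_le_ofReal hc h

lemma willmore_union_le (hf : ContDiff ℝ 1 f) (Ω Ω' : Set (ℝ × ℝ)) :
    willmore f (Ω ∪ Ω') ≤ willmore f Ω + willmore f Ω' := by
  simp only [← lintegral_eq_willmore hf]
  exact lintegral_union_le _ _ _

lemma willmore_band_three_le (hf : ContDiff ℝ 1 f) {s c : ℝ} (hc : 0 ≤ c)
    (h : ∀ r ∈ Icc (s - 1) (s + 1), willmore f (band r (r + 1)) ≤ ENNReal.ofReal c) :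
    willmore f (band (s - 1) (s + 2)) ≤ ENNReal.ofReal (3 * c) := by
  have hU : band (s - 1) (s + 2) =
      (band (s - 1) (s - 1 + 1) ∪ band s (s + 1)) ∪ band (s + 1) (s + 1 + 1) := by
    simp only [band, ← union_prod]
    rw [sub_add_cancel, Icc_union_Icc_eq_Icc (by linarith) (by linarith),
      Icc_union_Icc_eq_Icc (by linarith) (by linarith)]
    ring_nf
  have e3 : ENNReal.ofReal (3 * c) = ENNReal.ofReal c + ENNReal.ofReal c + ENNReal.ofReal c := by
    rw [← ENNReal.ofReal_add hc hc, ← ENNReal.ofReal_add (by positivity) hc]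
    ring_nf
  rw [hU, e3]
  exact (willmore_union_le hf _ _).trans (add_le_add ((willmore_union_le hf _ _).trans
    (add_le_add (h _ ⟨le_rfl, by linarith⟩) (h _ ⟨by linarith, by linarith⟩)))
    (h _ ⟨by linarith, le_rfl⟩))

lemma ae_restrict_band_mem_interior (a b : ℝ) :
    ∀ᵐ z ∂volume.restrict (band a b), z ∈ Ioo a b ×ˢ Ioo 0 (2 * π) := by
  rw [band, Measure.volume_eq_prod, ← Measure.prod_restrict,
    ← Measure.restrict_congr_set (Ioo_ae_eq_Icc (μ := volume) (a := a) (b := b)),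
    ← Measure.restrict_congr_set (Ioo_ae_eq_Icc (μ := volume) (a := 0) (b := 2 * π)),
    Measure.prod_restrict]
  exact ae_restrict_mem (measurableSet_Ioo.prod measurableSet_Ioo)

lemma integral_norm_mul_norm_lap_unit_le (hf : ContDiff ℝ 2 f)
    (hper : ∀ t θ : ℝ, f (t, θ + 2 * π) = f (t, θ))
    (hconf : ∀ z, ‖pd1 f z‖ ^ 2 = ‖pd2 f z‖ ^ 2 ∧ ⟪pd1 f z, pd2 f z⟫ = 0)
    (hlap : ∀ z, gradSq f z = 0 → lap f z = 0) {s ε : ℝ} (hε : 0 < ε) (hε' : ε ≤ 1 / 10)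
    (hW : ∀ r ∈ Icc (s - 1) (s + 1), willmore f (band r (r + 1)) ≤ ENNReal.ofReal (ε ^ 2)) :
    ∫ z in band s (s + 1), ‖f z - circleMean f z.1‖ * ‖lap f z‖ ≤
      26 * ε * ∫ z in band (s - 1) (s + 2), gradSq f z := by
  have hf1 : ContDiff ℝ 1 f := hf.of_le (by norm_num)
  have hg := continuous_gradSq hf1
  have hl := continuous_lap hf
  have hm := continuous_circleMean hf.continuous
  have hfc := hf.continuous
  obtain ⟨hH3, hI3⟩ := integrableOn_and_integral_le_of_willmore_le hf (by positivity)
    (willmore_band_three_le hf1 (sq_nonneg ε) hW)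
  obtain ⟨hH1, hI1⟩ := integrableOn_and_integral_le_of_willmore_le hf (sq_nonneg ε)
    (hW s ⟨by linarith, by linarith⟩)
  set E := ∫ z in band (s - 1) (s + 2), gradSq f z with hE
  have hE0 : 0 ≤ E := integral_nonneg fun z => gradSq_nonneg z
  have hE1 : ∫ z in band s (s + 1), gradSq f z ≤ E :=
    setIntegral_mono_set (hg.integrableOn_band _ _) (ae_of_all _ fun z => gradSq_nonneg z)
      (band_subset (by linarith) (by linarith)).eventuallyLE
  refine le_of_forall_pos_le_add fun δ hδ => ?_
  set e := √(E + δ / (26 * ε)) with he_def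
  have he : 0 < e := Real.sqrt_pos.2 (by positivity)
  have he2 : e ^ 2 = E + δ / (26 * ε) := Real.sq_sqrt (by positivity)
  have hEe : E ≤ e ^ 2 := by rw [he2]; linarith [show 0 ≤ δ / (26 * ε) by positivity]
  have hpt : ∀ᵐ z ∂volume.restrict (band s (s + 1)),
      ‖f z - circleMean f z.1‖ * ‖lap f z‖ ≤
        13 * ε * gradSq f z + 13 * e ^ 2 / ε * (‖lap f z‖ ^ 2 / gradSq f z) := by
    filter_upwards [ae_restrict_band_mem_interior s (s + 1)] with z hz
    by_cases h0 : gradSq f z = 0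
    · simp [hlap z h0, h0]
    · have hpos : 0 < gradSq f z := (gradSq_nonneg z).lt_of_ne' h0
      have ho := oscillation_bound hf hper hconf hlap he hEe hH3 (by nlinarith) hz h0
      refine (mul_le_mul_of_nonneg_right ho (norm_nonneg _)).trans ?_
      rw [← sub_nonneg]
      have : 13 * ε * gradSq f z + 13 * e ^ 2 / ε * (‖lap f z‖ ^ 2 / gradSq f z) -
          26 * e * ‖lap f z‖ = 13 * (ε * gradSq f z - e * ‖lap f z‖) ^ 2 / (ε * gradSq f z) := by
        field_simp
        ring
      rw [this]
      positivity
  have h1 : ∫ z in band s (s + 1), ‖f z - circleMean f z.1‖ * ‖lap f z‖ ≤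
      ∫ z in band s (s + 1), (13 * ε * gradSq f z +
        13 * e ^ 2 / ε * (‖lap f z‖ ^ 2 / gradSq f z)) := by
    refine integral_mono_ae ?_ (((hg.integrableOn_band _ _).const_mul _).add (hH1.const_mul _)) hpt
    exact (by fun_prop : Continuous fun z : ℝ × ℝ =>
      ‖f z - circleMean f z.1‖ * ‖lap f z‖).integrableOn_band _ _
  rw [integral_add ((hg.integrableOn_band _ _).const_mul _) (hH1.const_mul _),
    integral_const_mul, integral_const_mul] at h1
  have h2 : 13 * e ^ 2 / ε * ∫ z in band s (s + 1), ‖lap f z‖ ^ 2 / gradSq f z ≤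
      13 * ε * e ^ 2 := by
    calc _ ≤ 13 * e ^ 2 / ε * ε ^ 2 := by gcongr
      _ = _ := by field_simp
  have h3 : 13 * ε * ∫ z in band s (s + 1), gradSq f z ≤ 13 * ε * e ^ 2 := by
    gcongr
    exact hE1.trans hEe
  have h4 : 26 * ε * e ^ 2 = 26 * ε * E + δ := by rw [he2]; field_simp
  linarith

lemma sum_integral_unit_intervals {u : ℝ → ℝ} (hu : Continuous u) (c : ℝ) (N : ℕ) :
    ∑ j ∈ Finset.range N, ∫ r in (c + j)..(c + j + 1), u r = ∫ r in c..(c + N), u r := by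
  have h := intervalIntegral.sum_integral_adjacent_intervals (f := u) (μ := volume)
    (a := fun j : ℕ => c + j) (n := N) fun k _ => hu.intervalIntegrable _ _
  simpa [add_assoc] using h

lemma integral_norm_mul_norm_lap_le (hf : ContDiff ℝ 2 f)
    (hper : ∀ t θ : ℝ, f (t, θ + 2 * π) = f (t, θ))
    (hconf : ∀ z, ‖pd1 f z‖ ^ 2 = ‖pd2 f z‖ ^ 2 ∧ ⟪pd1 f z, pd2 f z⟫ = 0)
    (hlap : ∀ z, gradSq f z = 0 → lap f z = 0) {T t ε : ℝ} (hε : 0 < ε) (hε' : ε ≤ 1 / 10)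
    (hW : ∀ r ∈ Icc (-T) (T - 1), willmore f (band r (r + 1)) ≤ ENNReal.ofReal (ε ^ 2))
    (ht : t ∈ Icc 0 (T - 2)) :
    ∫ z in band (-t) t, ‖f z - circleMean f z.1‖ * ‖lap f z‖ ≤
      78 * ε * ∫ z in band (-(t + 2)) (t + 2), gradSq f z := by
  obtain ⟨ht0, htT⟩ := ht
  have hl := continuous_lap hf
  have hm := continuous_circleMean hf.continuous
  have hfc := hf.continuous
  have hg := continuous_gradSq (hf.of_le (by norm_num) : ContDiff ℝ 1 f)
  have hP : Continuous fun z : ℝ × ℝ => ‖f z - circleMean f z.1‖ * ‖lap f z‖ := by fun_prop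
  have hA := continuous_slice_integral hg
  set A := fun t => ∫ θ in (0 : ℝ)..2 * π, gradSq f (t, θ) with hA_def
  obtain ⟨N, hN, hN'⟩ : ∃ N : ℕ, 2 * t ≤ N ∧ (N : ℝ) < 2 * t + 1 :=
    ⟨⌈2 * t⌉₊, Nat.le_ceil _, Nat.ceil_lt_add_one (by positivity)⟩
  have hunit : ∀ j ∈ Finset.range N,
      ∫ r in (-t + j)..(-t + j + 1), ∫ θ in (0 : ℝ)..2 * π,
        ‖f (r, θ) - circleMean f r‖ * ‖lap f (r, θ)‖ ≤
      26 * ε * ((∫ r in (-t - 1 + j)..(-t - 1 + j + 1), A r) +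
        (∫ r in (-t + j)..(-t + j + 1), A r) +
        ∫ r in (-t + 1 + j)..(-t + 1 + j + 1), A r) := by
    intro j hj
    have hj0 : (0 : ℝ) ≤ j := by positivity
    have hjN : (j : ℝ) + 1 ≤ N := by exact_mod_cast Finset.mem_range.1 hj
    have h := integral_norm_mul_norm_lap_unit_le hf hper hconf hlap (s := -t + j) hε hε'
      fun r hr => hW r ⟨by linarith [hr.1], by linarith [hr.2]⟩
    rw [integral_band hP (by linarith), integral_band hg (by linarith)] at h
    refine h.trans_eq ?_
    rw [show -t - 1 + (j : ℝ) = -t + j - 1 by ring, sub_add_cancel,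
      show -t + 1 + (j : ℝ) = -t + j + 1 by ring,
      show -t + (j : ℝ) + 1 + 1 = -t + j + 2 by ring,
      intervalIntegral.integral_add_adjacent_intervals (hA.intervalIntegrable _ _)
        (hA.intervalIntegrable _ _),
      intervalIntegral.integral_add_adjacent_intervals (hA.intervalIntegrable _ _)
        (hA.intervalIntegrable _ _)]
  have hsum := Finset.sum_le_sum hunit
  rw [← Finset.mul_sum, Finset.sum_add_distrib, Finset.sum_add_distrib,
    sum_integral_unit_intervals hA, sum_integral_unit_intervals hA,
    sum_integral_unit_intervals hA,
    sum_integral_unit_intervals (continuous_slice_integral hP),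
    ← integral_band hP (by linarith), hA_def] at hsum
  simp only [← integral_band hg (show -t - 1 ≤ -t - 1 + N by linarith),
    ← integral_band hg (show -t ≤ -t + N by linarith),
    ← integral_band hg (show -t + 1 ≤ -t + 1 + N by linarith)] at hsum
  have hmono : ∀ a b, -(t + 2) ≤ a → b ≤ t + 2 → ∫ z in band a b, gradSq f z ≤
      ∫ z in band (-(t + 2)) (t + 2), gradSq f z := fun a b ha hb =>
    setIntegral_mono_set (hg.integrableOn_band _ _) (ae_of_all _ fun z => gradSq_nonneg z)
      (band_subset ha hb).eventuallyLE
  have h1 := hmono (-t - 1) (-t - 1 + N) (by linarith) (by linarith)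
  have h2 := hmono (-t) (-t + N) (by linarith) (by linarith)
  have h3 := hmono (-t + 1) (-t + 1 + N) (by linarith) (by linarith)
  have h0 : ∫ z in band (-t) t, ‖f z - circleMean f z.1‖ * ‖lap f z‖ ≤
      ∫ z in band (-t) (-t + N), ‖f z - circleMean f z.1‖ * ‖lap f z‖ :=
    setIntegral_mono_set (hP.integrableOn_band _ _) (ae_of_all _ fun z => by positivity)
      (band_subset le_rfl (by linarith)).eventuallyLE
  have h4 := mul_le_mul_of_nonneg_left (add_le_add (add_le_add h1 h2) h3)
    (by positivity : 0 ≤ 26 * ε)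
  linarith

lemma abs_integral_inner_sub_circleMean_le (hf : ContDiff ℝ 1 f)
    (hper : ∀ t θ : ℝ, f (t, θ + 2 * π) = f (t, θ)) (r : ℝ) :
    |∫ θ in (0 : ℝ)..2 * π, ⟪f (r, θ) - circleMean f r, pd1 f (r, θ)⟫| ≤
      1 / 2 * ∫ θ in (0 : ℝ)..2 * π, gradSq f (r, θ) := by
  have hpi : (0 : ℝ) ≤ 2 * π := by positivity
  have hd : Differentiable ℝ f := hf.differentiable (by norm_num)
  have hc1 : Continuous (pd1 f) := (hf.pd1 (m := 0) (by norm_num)).continuous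
  have hc2 : Continuous (pd2 f) := (hf.pd2 (m := 0) (by norm_num)).continuous
  have hfc := hf.continuous
  have hw := wirtinger (u := fun θ => f (r, θ) - circleMean f r) (u' := fun θ => pd2 f (r, θ))
    (fun θ => (hasDerivAt_pd2 hd r θ).sub_const _) (by fun_prop)
    (by have := hper r 0; rw [zero_add] at this; simp only [this])
    (by
      rw [intervalIntegral.integral_sub
        ((by fun_prop : Continuous fun θ => f (r, θ)).intervalIntegrable _ _)
        intervalIntegrable_const, intervalIntegral.integral_const, sub_zero,
        two_pi_smul_circleMean, sub_self])
  have i1 : IntervalIntegrable (fun θ => ‖f (r, θ) - circleMean f r‖ ^ 2) volume 0 (2 * π) :=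
    (by fun_prop : Continuous fun θ => ‖f (r, θ) - circleMean f r‖ ^ 2).intervalIntegrable _ _
  have i2 : IntervalIntegrable (fun θ => ‖pd1 f (r, θ)‖ ^ 2) volume 0 (2 * π) :=
    (by fun_prop : Continuous fun θ => ‖pd1 f (r, θ)‖ ^ 2).intervalIntegrable _ _
  have i3 : IntervalIntegrable (fun θ => ‖pd2 f (r, θ)‖ ^ 2) volume 0 (2 * π) :=
    (by fun_prop : Continuous fun θ => ‖pd2 f (r, θ)‖ ^ 2).intervalIntegrable _ _
  have h := intervalIntegral.norm_integral_le_of_norm_le hpi (μ := volume)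
    (f := fun θ => ⟪f (r, θ) - circleMean f r, pd1 f (r, θ)⟫)
    (g := fun θ => 1 / 2 * (‖f (r, θ) - circleMean f r‖ ^ 2 + ‖pd1 f (r, θ)‖ ^ 2))
    (ae_of_all _ fun θ _ => by
      refine (norm_inner_le_norm _ _).trans ?_
      nlinarith [sq_nonneg (‖f (r, θ) - circleMean f r‖ - ‖pd1 f (r, θ)‖)])
    ((i1.add i2).const_mul _)
  rw [intervalIntegral.integral_const_mul, intervalIntegral.integral_add i1 i2,
    Real.norm_eq_abs] at h
  simp only [gradSq]
  rw [intervalIntegral.integral_add i2 i3]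
  linarith

lemma integral_inner_circleMean (hX : Continuous X) (t : ℝ) (c : EuclideanSpace ℝ (Fin n)) :
    ∫ θ in (0 : ℝ)..2 * π, ⟪c, X (t, θ)⟫ = 2 * π * ⟪c, circleMean X t⟫ := by
  have h := (innerSL ℝ c).intervalIntegral_comp_comm (μ := volume)
    ((by fun_prop : Continuous fun θ => X (t, θ)).intervalIntegrable 0 (2 * π))
  simp only [innerSL_apply_apply] at h
  rw [h, ← two_pi_smul_circleMean, inner_smul_right]

lemma energy_le_boundary (hf : ContDiff ℝ 2 f)
    (hper : ∀ t θ : ℝ, f (t, θ + 2 * π) = f (t, θ))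
    (hconf : ∀ z, ‖pd1 f z‖ ^ 2 = ‖pd2 f z‖ ^ 2) {a b : ℝ} (hab : a ≤ b) :
    1 / 2 * ∫ z in band a b, gradSq f z ≤
      1 / 2 * ((∫ θ in (0 : ℝ)..2 * π, gradSq f (b, θ)) +
        ∫ θ in (0 : ℝ)..2 * π, gradSq f (a, θ)) +
      ∫ z in band a b, ‖f z - circleMean f z.1‖ * ‖lap f z‖ := by
  have hf1 : ContDiff ℝ 1 f := hf.of_le (by norm_num)
  have hd : Differentiable ℝ f := hf.differentiable (by norm_num)
  have hc1 : Continuous (pd1 f) := (hf1.pd1 (m := 0) (by norm_num)).continuous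
  have hg := continuous_gradSq hf1
  have hl := continuous_lap hf
  have hm := continuous_circleMean hf.continuous
  have hm' := continuous_circleMean hc1
  have hfc := hf.continuous
  have hX : ContDiff ℝ 1 fun z : ℝ × ℝ => f z - circleMean f z.1 :=
    hf1.sub ((contDiff_circleMean hf1).comp contDiff_fst)
  have hXd := hX.differentiable (by norm_num)
  have p1 : ∀ z, pd1 (fun z : ℝ × ℝ => f z - circleMean f z.1) z =
      pd1 f z - circleMean (pd1 f) z.1 := fun z =>
    (hasDerivAt_pd1 hXd z.1 z.2).unique
      ((hasDerivAt_pd1 hd z.1 z.2).sub (hasDerivAt_circleMean hf1 z.1))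
  have p2 : ∀ z, pd2 (fun z : ℝ × ℝ => f z - circleMean f z.1) z = pd2 f z := fun z =>
    (hasDerivAt_pd2 hXd z.1 z.2).unique ((hasDerivAt_pd2 hd z.1 z.2).sub_const (circleMean f z.1))
  have key := green_band hf hX hper (fun t θ => by simp only [hper]) hab
  have hint : ∀ z, ⟪pd1 (fun z : ℝ × ℝ => f z - circleMean f z.1) z, pd1 f z⟫ +
      ⟪pd2 (fun z : ℝ × ℝ => f z - circleMean f z.1) z, pd2 f z⟫ +
      ⟪f z - circleMean f z.1, lap f z⟫ =
      gradSq f z - ⟪circleMean (pd1 f) z.1, pd1 f z⟫ + ⟪f z - circleMean f z.1, lap f z⟫ := by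
    intro z
    rw [p1, p2, inner_sub_left, real_inner_self_eq_norm_sq, real_inner_self_eq_norm_sq, gradSq]
    ring
  simp only [hint] at key
  have c3 : Continuous fun z : ℝ × ℝ => ⟪circleMean (pd1 f) z.1, pd1 f z⟫ := by fun_prop
  have c4 : Continuous fun z : ℝ × ℝ => ⟪f z - circleMean f z.1, lap f z⟫ := by fun_prop
  have c5 : Continuous fun z : ℝ × ℝ => gradSq f z - ⟪circleMean (pd1 f) z.1, pd1 f z⟫ := by
    fun_prop
  rw [integral_add (c5.integrableOn_band _ _) (c4.integrableOn_band _ _),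
    integral_sub (hg.integrableOn_band _ _) (c3.integrableOn_band _ _),
    integral_band c3 hab] at key
  simp only [integral_inner_circleMean hc1, real_inner_self_eq_norm_sq,
    intervalIntegral.integral_const_mul] at key
  have h1 := integral_norm_circleMean_pd1_sq_le hf1 hconf hab
  have h2 := abs_le.1 (abs_integral_inner_sub_circleMean_le hf1 hper a)
  have h3 := abs_le.1 (abs_integral_inner_sub_circleMean_le hf1 hper b)
  have h4 : -∫ z in band a b, ⟪f z - circleMean f z.1, lap f z⟫ ≤
      ∫ z in band a b, ‖f z - circleMean f z.1‖ * ‖lap f z‖ := by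
    rw [← integral_neg]
    refine integral_mono (c4.neg.integrableOn_band _ _)
      ((by fun_prop : Continuous fun z : ℝ × ℝ =>
        ‖f z - circleMean f z.1‖ * ‖lap f z‖).integrableOn_band _ _) fun z => ?_
    exact (neg_le_abs _).trans (abs_real_inner_le_norm _ _)
  linarith [h2.1, h2.2, h3.1, h3.2]

lemma hasDerivAt_integral_band {u : ℝ × ℝ → ℝ} (hu : Continuous u) {t : ℝ} (ht : 0 < t) :
    HasDerivAt (fun r => ∫ z in band (-r) r, u z)
      ((∫ θ in (0 : ℝ)..2 * π, u (t, θ)) + ∫ θ in (0 : ℝ)..2 * π, u (-t, θ)) t := by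
  have hA := continuous_slice_integral hu
  set A := fun t => ∫ θ in (0 : ℝ)..2 * π, u (t, θ)
  have h1 := (hA.integral_hasStrictDerivAt 0 t).hasDerivAt
  have h2 := ((hA.integral_hasStrictDerivAt 0 (-t)).hasDerivAt).comp t (hasDerivAt_neg t)
  have h := h1.sub h2
  rw [mul_neg_one, sub_neg_eq_add] at h
  refine h.congr_of_eventuallyEq ?_
  filter_upwards [lt_mem_nhds ht] with r hr
  rw [integral_band hu (by linarith)]
  exact (intervalIntegral.integral_interval_sub_left (hA.intervalIntegrable _ _)
    (hA.intervalIntegrable _ _)).symm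

lemma fderiv_eq_zero_of_gradSq_eq_zero {z : ℝ × ℝ} (h : gradSq f z = 0) : fderiv ℝ f z = 0 := by
  have h1 : fderiv ℝ f z (1, 0) = 0 := by
    change pd1 f z = 0
    rw [← norm_eq_zero, ← sq_eq_zero_iff]
    unfold gradSq at h
    nlinarith [sq_nonneg ‖pd1 f z‖, sq_nonneg ‖pd2 f z‖]
  have h2 : fderiv ℝ f z (0, 1) = 0 := by
    change pd2 f z = 0
    rw [← norm_eq_zero, ← sq_eq_zero_iff]
    unfold gradSq at h
    nlinarith [sq_nonneg ‖pd1 f z‖, sq_nonneg ‖pd2 f z‖]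
  refine ContinuousLinearMap.ext fun v => ?_
  have hv : v = v.1 • ((1, 0) : ℝ × ℝ) + v.2 • ((0, 1) : ℝ × ℝ) := by ext <;> simp
  rw [hv, map_add, map_smul, map_smul, h1, h2]
  simp

end CylinderCalculus

/-- Differential inequality for the cylinder energy (combination of (en) and (id3) in
Proposition 2.3). -/
theorem cylinder_energy_differential_inequality (n : ℕ) (hn : 1 ≤ n) :
    ∃ ε₂ > (0:ℝ), ∃ C > (0:ℝ),
      ∀ T : ℝ, 3 ≤ T →
        ∀ f : ℝ × ℝ → EuclideanSpace ℝ (Fin n),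
          ContDiff ℝ (⊤ : ℕ∞) f →
          (∀ t θ : ℝ, f (t, θ + 2 * π) = f (t, θ)) →
          (∀ z, ‖pd1 f z‖ ^ 2 = ‖pd2 f z‖ ^ 2 ∧ ⟪pd1 f z, pd2 f z⟫ = 0) →
          (∀ z, fderiv ℝ f z = 0 → lap f z = 0) →
          ∀ ε : ℝ, 0 < ε → ε ≤ ε₂ →
            (∀ s ∈ Icc (-T) (T - 1),
                willmore f (Icc s (s + 1) ×ˢ Icc 0 (2 * π)) < ENNReal.ofReal (ε ^ 2)) →
            ∀ t ∈ Icc (0:ℝ) (T - 2),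
              (1/2) * (∫ z in Icc (-t) t ×ˢ Icc 0 (2 * π), gradSq f z) ≤
                deriv (fun r : ℝ =>
                    (1/2) * ∫ z in Icc (-r) r ×ˢ Icc 0 (2 * π), gradSq f z) t +
                C * ε * ((1/2) * ∫ z in Icc (-(t + 2)) (t + 2) ×ˢ Icc 0 (2 * π), gradSq f z) := by
  refine ⟨1 / 10, by norm_num, 156, by norm_num, ?_⟩
  intro T _ f hf' hper hconf hlap' ε hε hε' hW t ht
  have hf : ContDiff ℝ 2 f := contDiff_infty.1 hf' 2
  have hg := continuous_gradSq (hf.of_le (by norm_num) : ContDiff ℝ 1 f)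
  have hlap : ∀ z, gradSq f z = 0 → lap f z = 0 := fun z hz =>
    hlap' z (fderiv_eq_zero_of_gradSq_eq_zero hz)
  have h1 := energy_le_boundary hf hper (fun z => (hconf z).1) (show -t ≤ t by linarith [ht.1])
  have h2 := integral_norm_mul_norm_lap_le hf hper hconf hlap hε hε' (fun r hr => (hW r hr).le) ht
  change 1 / 2 * ∫ z in band (-t) t, gradSq f z ≤
    deriv (fun r : ℝ => 1 / 2 * ∫ z in band (-r) r, gradSq f z) t +
      156 * ε * (1 / 2 * ∫ z in band (-(t + 2)) (t + 2), gradSq f z)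
  rcases ht.1.lt_or_eq with ht0 | rfl
  · rw [((hasDerivAt_integral_band hg ht0).const_mul (1 / 2)).deriv]
    linarith
  · have h0 : ∫ z in band (-0) 0, gradSq f z = 0 := by
      rw [neg_zero, integral_band hg le_rfl, intervalIntegral.integral_same]
    have hmin : IsLocalMin (fun r : ℝ => 1 / 2 * ∫ z in band (-r) r, gradSq f z) 0 :=
      Eventually.of_forall fun r => by
        beta_reduce
        rw [h0, mul_zero]
        exact mul_nonneg (by norm_num) (integral_nonneg fun z => gradSq_nonneg z)
    have h3 : 0 ≤ ∫ z in band (-(0 + 2)) (0 + 2), gradSq f z :=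
      integral_nonneg fun z => gradSq_nonneg z
    rw [h0, hmin.deriv_eq_zero, mul_zero, zero_add]
    positivity
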